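/- arXiv:1401.3093 — 7 statements merged into one kernel-verified Lean document; each statement's English description precedes it below -/
import Mathlib

section
/- Let n and D be positive integers. Every code C ⊆ S_n whose average Kendall τ-distortion is at most D, i.e. (1/n!)·∑_{π∈S_n} d_K(π,C) ≤ D, satisfies |C| > n!/(B_K(D)·(D+1)). -/
/-- The set of adjacent transpositions in `S_n`. -/
def adjacentTranspositions (n : ℕ) : Set (Equiv.Perm (Fin n)) :=
  {t | ∃ (i : ℕ) (h : i + 1 < n), t = Equiv.swap ⟨i, Nat.lt_of_succ_lt h⟩ ⟨i + 1, h⟩}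

/-- Kendall τ-distance: the minimum number of adjacent transpositions
needed to transform `π` into `σ`. -/
noncomputable def kendallDist {n : ℕ} (π σ : Equiv.Perm (Fin n)) : ℕ :=
  sInf {k | ∃ l : List (Equiv.Perm (Fin n)), l.length = k ∧
    (∀ t ∈ l, t ∈ adjacentTranspositions n) ∧ σ = π * l.prod}

/-- `kendallBall n r` is the number of permutations in `S_n` at Kendall
τ-distance at most `r` from the identity. -/
noncomputable def kendallBall (n r : ℕ) : ℕ :=
  (Finset.univ.filter (fun σ : Equiv.Perm (Fin n) => kendallDist σ 1 ≤ r)).card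

/-- The minimal Kendall τ-distance from `π` to a codeword of `C`. -/
noncomputable def kendallDistToCode {n : ℕ} (π : Equiv.Perm (Fin n))
    (C : Finset (Equiv.Perm (Fin n))) : ℕ :=
  sInf (kendallDist π '' ↑C)

theorem exists_list_adjacentTranspositions_prod_eq {n : ℕ} (π : Equiv.Perm (Fin n)) :
    ∃ l : List (Equiv.Perm (Fin n)), (∀ t ∈ l, t ∈ adjacentTranspositions n) ∧ l.prod = π := by
  cases n with
  | zero => exact ⟨[], by simp, Subsingleton.elim _ _⟩
  | succ m =>
    refine Submonoid.exists_list_of_mem_closure (s := adjacentTranspositions (m + 1)) ?_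
    refine Submonoid.closure_mono ?_
      (Equiv.Perm.mclosure_swap_castSucc_succ m ▸ Submonoid.mem_top π)
    rintro _ ⟨i, rfl⟩
    exact ⟨i, by lia, rfl⟩

theorem eq_of_kendallDist_eq_zero {n : ℕ} {π σ : Equiv.Perm (Fin n)}
    (h : kendallDist π σ = 0) : π = σ := by
  rcases Nat.sInf_eq_zero.mp h with ⟨l, hl, -, hσ⟩ | hempty
  · rw [List.length_eq_zero_iff] at hl
    simp [hσ, hl]
  · obtain ⟨l, hl, hprod⟩ := exists_list_adjacentTranspositions_prod_eq (π⁻¹ * σ)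
    exact (Set.eq_empty_iff_forall_notMem.mp hempty l.length ⟨l, rfl, hl, by simp [hprod]⟩).elim

theorem kendallDist_mul_left {n : ℕ} (τ π σ : Equiv.Perm (Fin n)) :
    kendallDist (τ * π) (τ * σ) = kendallDist π σ := by
  simp only [kendallDist, mul_assoc, mul_right_inj]

theorem kendallDist_self {n : ℕ} (π : Equiv.Perm (Fin n)) : kendallDist π π = 0 :=
  Nat.le_zero.mp (Nat.sInf_le ⟨[], by simp⟩)

theorem kendallBall_pos (n r : ℕ) : 0 < kendallBall n r :=
  Finset.card_pos.mpr ⟨1, by simp [kendallDist_self]⟩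

theorem one_lt_kendallBall {n r : ℕ} (hn : 1 < n) (hr : 0 < r) : 1 < kendallBall n r := by
  let s : Equiv.Perm (Fin n) := Equiv.swap ⟨0, Nat.lt_of_succ_lt hn⟩ ⟨0 + 1, hn⟩
  have hs : kendallDist s 1 ≤ 1 := by
    refine Nat.sInf_le ⟨[s], rfl, ?_, ?_⟩
    · simpa using ⟨0, hn, rfl⟩
    · simp [s]
  refine Finset.one_lt_card.mpr ⟨1, by simp [kendallDist_self], s, ?_, ?_⟩
  · simpa using hs.trans hr
  · intro h
    exact absurd (Equiv.swap_eq_one_iff.mp h.symm) (by simp)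

theorem card_filter_kendallDist_le {n : ℕ} (r : ℕ) (σ : Equiv.Perm (Fin n)) :
    (Finset.univ.filter (fun π => kendallDist π σ ≤ r)).card = kendallBall n r := by
  refine Finset.card_equiv (Equiv.mulLeft σ⁻¹) fun π => ?_
  have h := kendallDist_mul_left σ⁻¹ π σ
  rw [inv_mul_cancel] at h
  simp [h]

theorem exists_kendallDist_eq_kendallDistToCode {n : ℕ} (π : Equiv.Perm (Fin n))
    {C : Finset (Equiv.Perm (Fin n))} (hC : C.Nonempty) :
    ∃ σ ∈ C, kendallDist π σ = kendallDistToCode π C :=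
  Nat.sInf_mem (hC.to_set.image (kendallDist π))

theorem card_filter_kendallDistToCode_le {n : ℕ} (r : ℕ) {C : Finset (Equiv.Perm (Fin n))}
    (hC : C.Nonempty) :
    (Finset.univ.filter (fun π => kendallDistToCode π C ≤ r)).card
      ≤ C.card * kendallBall n r := by
  classical
  refine (Finset.card_le_card (t := C.biUnion fun σ =>
    Finset.univ.filter fun π => kendallDist π σ ≤ r) fun π hπ => ?_).trans
    (Finset.card_biUnion_le_card_mul _ _ _ fun σ _ => (card_filter_kendallDist_le r σ).le)
  obtain ⟨σ, hσ, h⟩ := exists_kendallDist_eq_kendallDistToCode π hC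
  simp only [Finset.mem_filter, Finset.mem_univ, true_and, Finset.mem_biUnion] at hπ ⊢
  exact ⟨σ, hσ, h ▸ hπ⟩

/-- Permutations outside the code contribute at least `1` to the total distortion, and those at
distance more than `D` from it contribute at least `D + 1`. -/
theorem factorial_le_of_sum_kendallDistToCode_le {n : ℕ} (D : ℕ)
    (C : Finset (Equiv.Perm (Fin n))) (hC : C.Nonempty)
    (hsum : ∑ π : Equiv.Perm (Fin n), kendallDistToCode π C ≤ D * n.factorial) :
    n.factorial ≤ C.card * (kendallBall n D * D + 1) := by
  classical
  have hpoint : ∀ π : Equiv.Perm (Fin n), D + 1 ≤ kendallDistToCode π C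
      + D * (if kendallDistToCode π C ≤ D then 1 else 0) + (if π ∈ C then 1 else 0) := by
    intro π
    obtain ⟨σ, hσ, h⟩ := exists_kendallDist_eq_kendallDistToCode π hC
    have hmem : kendallDistToCode π C = 0 → π ∈ C := fun h0 =>
      eq_of_kendallDist_eq_zero (h.trans h0) ▸ hσ
    split_ifs <;> grind
  have htotal := Finset.sum_le_sum fun π (_ : π ∈ Finset.univ) => hpoint π
  rw [Finset.sum_const, Finset.sum_add_distrib, Finset.sum_add_distrib, ← Finset.mul_sum, Finset.sum_boole,
    Finset.sum_boole, Finset.card_univ, Fintype.card_perm, Fintype.card_fin,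
    Finset.filter_univ_mem, smul_eq_mul] at htotal
  have hball := Nat.mul_le_mul_left D (card_filter_kendallDistToCode_le D hC)
  simp only [Nat.cast_id] at htotal
  nlinarith

/-- Every code in `S_n` with average Kendall τ-distortion at most `D`
has more than `n! / (B_K(D)·(D+1))` codewords. -/
theorem stmt_0 (n D : ℕ) (hn : 0 < n) (hD : 0 < D)
    (C : Finset (Equiv.Perm (Fin n))) (hC : C.Nonempty)
    (havg : (∑ π : Equiv.Perm (Fin n), (kendallDistToCode π C : ℝ)) / (n.factorial : ℝ) ≤ D) :
    (C.card : ℝ) > (n.factorial : ℝ) / ((kendallBall n D : ℝ) * ((D : ℝ) + 1)) := by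
  have hN : (0 : ℝ) < n.factorial := by exact_mod_cast n.factorial_pos
  have hsum : ∑ π : Equiv.Perm (Fin n), kendallDistToCode π C ≤ D * n.factorial := by
    rw [div_le_iff₀ hN] at havg
    exact_mod_cast havg
  have hcard : (0 : ℕ) < C.card := hC.card_pos
  have hle := factorial_le_of_sum_kendallDistToCode_le D C hC hsum
  have hB := kendallBall_pos n D
  have key : n.factorial < C.card * (kendallBall n D * (D + 1)) := by
    rcases Nat.lt_or_ge 1 n with h | h
    · have hB2 := one_lt_kendallBall h hD
      refine hle.trans_lt (Nat.mul_lt_mul_of_pos_left ?_ hcard)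
      rw [mul_add_one]
      lia
    · obtain rfl : n = 1 := le_antisymm h hn
      have hpos : 1 ≤ C.card * kendallBall 1 D := Nat.mul_pos hcard hB
      rw [Nat.factorial_one]
      nlinarith
  rw [gt_iff_lt, div_lt_iff₀ (by positivity)]
  exact_mod_cast key
end

section
/- Let n and D be positive integers. Every code C ⊆ S_n whose average Chebyshev distortion is at most D, i.e. (1/n!)·∑_{π∈S_n} d_C(π,C) ≤ D, satisfies |C| > n!/(B_C(D)·(D+1)). -/
/-- Chebyshev distance between two permutations: the maximum of `|π i - σ i|`. -/
def chebDist {n : ℕ} (π σ : Equiv.Perm (Fin n)) : ℕ :=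
  Finset.univ.sup fun i => Nat.dist (π i : ℕ) (σ i : ℕ)

/-- `chebBall n r` is the number of permutations in `S_n` at Chebyshev
distance at most `r` from the identity. -/
def chebBall (n r : ℕ) : ℕ :=
  (Finset.univ.filter (fun σ : Equiv.Perm (Fin n) => chebDist σ 1 ≤ r)).card

/-- The minimal Chebyshev distance from `π` to a codeword of `C`. -/
noncomputable def chebDistToCode {n : ℕ} (π : Equiv.Perm (Fin n))
    (C : Finset (Equiv.Perm (Fin n))) : ℕ :=
  sInf (chebDist π '' ↑C)

theorem chebDist_le_iff {n r : ℕ} {π σ : Equiv.Perm (Fin n)} :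
    chebDist π σ ≤ r ↔ ∀ i, Nat.dist (π i : ℕ) (σ i : ℕ) ≤ r := by
  simp [chebDist]

theorem eq_of_chebDist_eq_zero {n : ℕ} {π σ : Equiv.Perm (Fin n)} (h : chebDist π σ = 0) :
    π = σ := by
  ext i
  exact Nat.eq_of_dist_eq_zero (Nat.le_zero.mp (chebDist_le_iff.mp h.le i))

/-- One inequality of right-invariance: right multiplication does not increase the distance. -/
theorem chebDist_mul_right_le {n : ℕ} (π σ τ : Equiv.Perm (Fin n)) :
    chebDist (π * τ) (σ * τ) ≤ chebDist π σ :=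
  chebDist_le_iff.mpr fun i => chebDist_le_iff.mp le_rfl (τ i)

theorem exists_chebDist_eq_chebDistToCode {n : ℕ} {C : Finset (Equiv.Perm (Fin n))}
    (hC : C.Nonempty) (π : Equiv.Perm (Fin n)) :
    ∃ c ∈ C, chebDist π c = chebDistToCode π C :=
  Nat.sInf_mem (s := chebDist π '' ↑C) ((Finset.coe_nonempty.mpr hC).image _)

/-- A ball around any centre is at most as large as the ball around the identity. -/
theorem card_filter_chebDist_le {n : ℕ} (r : ℕ) (c : Equiv.Perm (Fin n)) :
    (Finset.univ.filter fun π : Equiv.Perm (Fin n) => chebDist π c ≤ r).card ≤ chebBall n r := by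
  refine Finset.card_le_card_of_injOn (· * c⁻¹) (fun π hπ => ?_)
    (mul_left_injective c⁻¹).injOn
  have hπ' : chebDist π c ≤ r := by simpa using hπ
  have h := (chebDist_mul_right_le π c c⁻¹).trans hπ'
  rw [mul_inv_cancel] at h
  simpa using h

/-- The sphere-covering bound. -/
theorem card_filter_chebDistToCode_le {n : ℕ} {C : Finset (Equiv.Perm (Fin n))}
    (hC : C.Nonempty) (r : ℕ) :
    (Finset.univ.filter fun π : Equiv.Perm (Fin n) => chebDistToCode π C ≤ r).card ≤
      C.card * chebBall n r := by
  classical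
  refine le_trans (Finset.card_le_card fun π hπ => ?_)
    (Finset.card_biUnion_le_card_mul C
      (fun c => Finset.univ.filter fun π : Equiv.Perm (Fin n) => chebDist π c ≤ r) _
      fun c _ => card_filter_chebDist_le r c)
  obtain ⟨c, hc, h⟩ := exists_chebDist_eq_chebDistToCode hC π
  simp only [Finset.mem_filter, Finset.mem_univ, true_and] at hπ
  simp only [Finset.mem_biUnion, Finset.mem_filter, Finset.mem_univ, true_and]
  exact ⟨c, hc, h.trans_le hπ⟩

theorem chebBall_pos (n r : ℕ) : 0 < chebBall n r :=
  Finset.card_pos.mpr ⟨1, by simp [chebDist_le_iff]⟩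

theorem one_lt_chebBall {n r : ℕ} (hn : 2 ≤ n) (hr : 0 < r) : 1 < chebBall n r := by
  refine Finset.one_lt_card.mpr
    ⟨1, by simp [chebDist_le_iff], Equiv.swap ⟨0, by omega⟩ ⟨1, by omega⟩, ?_, ?_⟩
  · simp only [Finset.mem_filter, Finset.mem_univ, true_and, chebDist_le_iff]
    intro i
    rw [Equiv.swap_apply_def]
    split_ifs with h₀ h₁ <;> simp_all [Nat.dist] <;> omega
  · intro h
    have := congrArg (fun σ : Equiv.Perm (Fin n) => σ ⟨0, by omega⟩) h
    simp at this

/-- Permutations farther than `r` from the code contribute at least `r + 1` to the total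
distortion, and those within `r` that are not codewords contribute at least `1`. -/
theorem factorial_mul_add_card_le_sum_chebDistToCode {n : ℕ} {C : Finset (Equiv.Perm (Fin n))}
    (hC : C.Nonempty) (r : ℕ) :
    n.factorial * (r + 1) +
        (Finset.univ.filter fun π : Equiv.Perm (Fin n) => chebDistToCode π C ≤ r).card ≤
      (∑ π, chebDistToCode π C) +
        (Finset.univ.filter fun π : Equiv.Perm (Fin n) => chebDistToCode π C ≤ r).card * (r + 1) +
        C.card := by
  classical
  have key : ∀ π : Equiv.Perm (Fin n),
      (r + 1) + (if chebDistToCode π C ≤ r then 1 else 0) ≤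
        chebDistToCode π C + (if chebDistToCode π C ≤ r then 1 else 0) * (r + 1) +
          (if π ∈ C then 1 else 0) := by
    intro π
    have hpos : π ∉ C → 0 < chebDistToCode π C := by
      intro hπ
      obtain ⟨c, hc, h⟩ := exists_chebDist_eq_chebDistToCode hC π
      refine Nat.pos_of_ne_zero fun h₀ => hπ ?_
      rwa [eq_of_chebDist_eq_zero (h.trans h₀)]
    by_cases hπ : π ∈ C
    · split_ifs <;> omega
    · have := hpos hπ
      split_ifs <;> omega
  have hsum := Finset.sum_le_sum fun π (_ : π ∈ Finset.univ) => key π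
  simp only [Finset.sum_add_distrib, ← Finset.sum_mul, Finset.sum_boole, Finset.sum_const,
    Finset.card_univ, Fintype.card_perm, Fintype.card_fin, smul_eq_mul, Nat.cast_id,
    Finset.filter_univ_mem] at hsum
  linarith

/-- Every code in `S_n` with average Chebyshev distortion at most `D`
has more than `n! / (B_C(D)·(D+1))` codewords. -/
theorem stmt_1 (n D : ℕ) (hn : 0 < n) (hD : 0 < D)
    (C : Finset (Equiv.Perm (Fin n))) (hC : C.Nonempty)
    (havg : (∑ π : Equiv.Perm (Fin n), (chebDistToCode π C : ℝ)) / (n.factorial : ℝ) ≤ D) :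
    (C.card : ℝ) > (n.factorial : ℝ) / ((chebBall n D : ℝ) * ((D : ℝ) + 1)) := by
  have hfac : (0 : ℝ) < n.factorial := by exact_mod_cast n.factorial_pos
  have hS : (∑ π, chebDistToCode π C) ≤ D * n.factorial := by
    rw [div_le_iff₀ hfac] at havg
    exact_mod_cast havg
  have hB := chebBall_pos n D
  have hCpos := hC.card_pos
  have hsum := factorial_mul_add_card_le_sum_chebDistToCode hC D
  have hcov := card_filter_chebDistToCode_le hC D
  suffices h : n.factorial < C.card * (chebBall n D * (D + 1)) by
    have hpos : (0 : ℝ) < (chebBall n D : ℝ) * ((D : ℝ) + 1) := by positivity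
    rw [gt_iff_lt, div_lt_iff₀ hpos]
    exact_mod_cast h
  rcases Nat.lt_or_ge n 2 with hn2 | hn2
  · obtain rfl : n = 1 := by omega
    rw [Nat.factorial_one]
    have h₁ : 0 < C.card * chebBall 1 D := Nat.mul_pos hCpos hB
    nlinarith
  · have hB2 := one_lt_chebBall hn2 hD
    generalize (Finset.univ.filter fun π : Equiv.Perm (Fin n) => chebDistToCode π C ≤ D).card = N
      at hsum hcov
    by_contra! hle
    have hND : N * (D + 1) ≤ C.card * chebBall n D * (D + 1) := Nat.mul_le_mul_right _ hcov
    have hNC : N ≤ C.card := by nlinarith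
    have hNC' : N * (D + 1) ≤ C.card * (D + 1) := Nat.mul_le_mul_right _ hNC
    have hlt : C.card * (D + 1) < C.card * (D + 1) * chebBall n D :=
      lt_mul_of_one_lt_right (by positivity) hB2
    nlinarith
end

section
/- Let n ≥ 2 and D ≥ 1 be integers. There exists a code C ⊆ S_n with |C| ≤ ⌈n!·ln(n!)/B_K(D)⌉ such that every permutation π ∈ S_n satisfies d_K(π,C) ≤ D. -/
/-- The Kendall τ-distance is invariant under left multiplication. -/
theorem kendallDist_eq_inv_mul {n : ℕ} (π σ : Equiv.Perm (Fin n)) :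
    kendallDist π σ = kendallDist (σ⁻¹ * π) 1 := by
  have h (l : List (Equiv.Perm (Fin n))) : σ = π * l.prod ↔ 1 = σ⁻¹ * π * l.prod := by
    rw [mul_assoc, eq_inv_mul_iff_mul_eq, mul_one]
  simp only [kendallDist, h]

section Covering

variable {G : Type*} [Group G] [Fintype G] [DecidableEq G]

/-- Some left translate of `S` meets `U` in at least the average number of elements. -/
theorem exists_card_mul_card_le_card_filter_mul (S U : Finset G) :
    ∃ g : G, U.card * S.card ≤ (U.filter (fun x => g⁻¹ * x ∈ S)).card * Fintype.card G := by
  have hsum : ∑ g : G, (U.filter (fun x => g⁻¹ * x ∈ S)).card = U.card * S.card := by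
    simp only [Finset.card_filter]
    rw [Finset.sum_comm, ← smul_eq_mul, ← Finset.sum_const]
    refine Finset.sum_congr rfl fun x _ => ?_
    rw [← Finset.card_filter]
    refine Finset.card_bij (fun g _ => g⁻¹ * x) (by simp) (by simp) fun s hs => ?_
    exact ⟨x * s⁻¹, by simpa using hs, by simp⟩
  by_contra! h
  have hlt := Finset.sum_lt_sum_of_nonempty (Finset.univ_nonempty (α := G)) fun g _ => h g
  rw [← Finset.sum_mul, hsum, Finset.sum_const, Finset.card_univ, smul_eq_mul, mul_comm] at hlt
  exact hlt.false

/-- Greedy covering: `k` left translates of `S` can be chosen so that the proportion of elements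
left uncovered is at most `(1 - |S| / |G|) ^ k`. -/
theorem exists_card_le_card_uncovered_le (S : Finset G) (k : ℕ) :
    ∃ C : Finset G, C.card ≤ k ∧
      ((Finset.univ.filter (fun x : G => ∀ g ∈ C, g⁻¹ * x ∉ S)).card : ℝ) ≤
        Fintype.card G * (1 - (S.card : ℝ) / Fintype.card G) ^ k := by
  have hN : (0 : ℝ) < Fintype.card G := by exact_mod_cast Fintype.card_pos
  induction k with
  | zero => exact ⟨∅, by simp⟩
  | succ k ih =>
    obtain ⟨C, hC, hU⟩ := ih
    set U := Finset.univ.filter (fun x : G => ∀ g ∈ C, g⁻¹ * x ∉ S) with hUdef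
    obtain ⟨g, hg⟩ := exists_card_mul_card_le_card_filter_mul S U
    refine ⟨insert g C, (Finset.card_insert_le _ _).trans (by omega), ?_⟩
    have hV : Finset.univ.filter (fun x : G => ∀ h ∈ insert g C, h⁻¹ * x ∉ S) =
        U.filter (fun x => ¬ g⁻¹ * x ∈ S) := by
      ext x
      simp [hUdef, and_comm]
    have hsplit : ((U.filter (fun x => g⁻¹ * x ∈ S)).card : ℝ) +
        (U.filter (fun x => ¬ g⁻¹ * x ∈ S)).card = U.card := by
      exact_mod_cast Finset.card_filter_add_card_filter_not (s := U) (fun x => g⁻¹ * x ∈ S)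
    have hg' : (U.card : ℝ) * S.card / Fintype.card G ≤
        (U.filter (fun x => g⁻¹ * x ∈ S)).card := by
      rw [div_le_iff₀ hN]
      exact_mod_cast hg
    have hfrac : 0 ≤ 1 - (S.card : ℝ) / Fintype.card G := by
      rw [sub_nonneg, div_le_one hN]
      exact_mod_cast Finset.card_le_univ S
    rw [hV]
    calc ((U.filter (fun x => ¬ g⁻¹ * x ∈ S)).card : ℝ)
        ≤ U.card - (U.card : ℝ) * S.card / Fintype.card G := by linarith
      _ = U.card * (1 - (S.card : ℝ) / Fintype.card G) := by ring
      _ ≤ Fintype.card G * (1 - (S.card : ℝ) / Fintype.card G) ^ k *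
          (1 - (S.card : ℝ) / Fintype.card G) := by gcongr
      _ = _ := by ring

/-- A finite group `G` is covered by `⌈|G| log |G| / |S|⌉` left translates of a nonempty `S`. -/
theorem exists_card_le_ceil_covering (S : Finset G) (hS : S.Nonempty) (hG : 1 < Fintype.card G) :
    ∃ C : Finset G,
      C.card ≤ ⌈(Fintype.card G : ℝ) * Real.log (Fintype.card G) / S.card⌉₊ ∧
      ∀ x : G, ∃ g ∈ C, g⁻¹ * x ∈ S := by
  set N : ℝ := (Fintype.card G : ℝ) with hNdef
  have hN : 1 < N := Nat.one_lt_cast.mpr hG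
  have hB : (0 : ℝ) < S.card := by exact_mod_cast hS.card_pos
  set M := ⌈N * Real.log N / S.card⌉₊ with hM
  obtain ⟨C, hC, hU⟩ := exists_card_le_card_uncovered_le S M
  rw [← hNdef] at hU
  refine ⟨C, hC, ?_⟩
  have hx : 0 < (S.card : ℝ) / N := by positivity
  have hM0 : M ≠ 0 := by
    have := Real.log_pos hN
    exact (Nat.ceil_pos.mpr (by positivity)).ne'
  have hMle : Real.log N ≤ M * (S.card / N) := by
    have := Nat.le_ceil (N * Real.log N / S.card)
    rw [← hM, div_le_iff₀ hB] at this
    rw [← mul_div_assoc, le_div_iff₀ (by linarith)]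
    linarith
  have hfrac : 0 ≤ 1 - (S.card : ℝ) / N := by
    rw [sub_nonneg, div_le_one (by linarith), hNdef]
    exact_mod_cast Finset.card_le_univ S
  have hlt : N * (1 - (S.card : ℝ) / N) ^ M < 1 := by
    calc N * (1 - (S.card : ℝ) / N) ^ M
        < N * Real.exp (-(S.card / N)) ^ M := by
          refine mul_lt_mul_of_pos_left (pow_lt_pow_left₀ ?_ hfrac hM0) (by linarith)
          linarith [Real.add_one_lt_exp (neg_ne_zero.mpr hx.ne')]
      _ = N * Real.exp (-(M * (S.card / N))) := by rw [← Real.exp_nat_mul, mul_neg]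
      _ ≤ N * Real.exp (-Real.log N) := by gcongr
      _ = 1 := by rw [Real.exp_neg, Real.exp_log (by linarith), mul_inv_cancel₀ (by linarith)]
  have hcard := hU.trans_lt hlt
  rw [Nat.cast_lt_one, Finset.card_eq_zero, Finset.filter_eq_empty_iff] at hcard
  intro x
  simpa using hcard (Finset.mem_univ x)

end Covering

/-- There is a covering code for worst-case Kendall τ-distortion `D` of size at most
`⌈n!·ln(n!)/B_K(D)⌉`. -/
theorem stmt_2 (n D : ℕ) (hn : 2 ≤ n) (hD : 1 ≤ D) :
    ∃ C : Finset (Equiv.Perm (Fin n)),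
      (C.card : ℤ) ≤ ⌈((n.factorial : ℝ) * Real.log (n.factorial : ℝ)) / (kendallBall n D : ℝ)⌉ ∧
      ∀ π : Equiv.Perm (Fin n), ∃ σ ∈ C, kendallDist π σ ≤ D := by
  have hcard : Fintype.card (Equiv.Perm (Fin n)) = n.factorial := by
    rw [Fintype.card_perm, Fintype.card_fin]
  obtain ⟨C, hC, hcover⟩ := exists_card_le_ceil_covering
    (Finset.univ.filter (fun σ : Equiv.Perm (Fin n) => kendallDist σ 1 ≤ D))
    (Finset.card_pos.mp (kendallBall_pos n D))
    (by rw [hcard]; exact hn.trans (Nat.self_le_factorial n))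
  rw [hcard] at hC
  refine ⟨C, ?_, fun π => ?_⟩
  · rw [← Int.natCast_ceil_eq_ceil (div_nonneg
      (mul_nonneg (Nat.cast_nonneg _) (Real.log_natCast_nonneg _)) (Nat.cast_nonneg _))]
    exact_mod_cast hC
  · obtain ⟨σ, hσ, h⟩ := hcover π
    exact ⟨σ, hσ, (kendallDist_eq_inv_mul π σ).trans_le (Finset.mem_filter.mp h).2⟩
end

section
/- Let n and D be positive integers, and set m = 1 + ⌊D/n⌋ (so m = ⌊1 + δ⌋ with δ = D/n). If m ≤ n, then B_K(D) ≥ m! · m^{n−m}. -/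
/-- Every `j` is the image of `0` under a product of `j` adjacent transpositions. -/
lemma exists_adjacentTranspositions_prod_zero (n j : ℕ) (hj : j < n + 1) :
    ∃ l : List (Equiv.Perm (Fin (n + 1))), l.length = j ∧
      (∀ t ∈ l, t ∈ adjacentTranspositions (n + 1)) ∧ l.prod 0 = ⟨j, hj⟩ := by
  induction j with
  | zero => exact ⟨[], rfl, by simp, rfl⟩
  | succ j ih =>
    obtain ⟨l, hlen, hadj, hprod⟩ := ih (by omega)
    refine ⟨Equiv.swap ⟨j, Nat.lt_of_succ_lt hj⟩ ⟨j + 1, hj⟩ :: l, by simp [hlen], ?_, ?_⟩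
    · rintro t ht
      rcases List.mem_cons.1 ht with rfl | ht
      · exact ⟨j, hj, rfl⟩
      · exact hadj t ht
    · simp [Equiv.Perm.mul_apply, hprod]

/-- The embedding of `S_n` into `S_{n+1}` as the stabilizer of `0`. -/
noncomputable def shiftHom (n : ℕ) : Equiv.Perm (Fin n) →* Equiv.Perm (Fin (n + 1)) :=
  Equiv.Perm.viaEmbeddingHom (Fin.succEmb n)

lemma shiftHom_injective (n : ℕ) : Function.Injective (shiftHom n) :=
  Equiv.Perm.viaEmbeddingHom_injective _

lemma shiftHom_succ {n : ℕ} (σ : Equiv.Perm (Fin n)) (i : Fin n) :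
    shiftHom n σ i.succ = (σ i).succ :=
  Equiv.Perm.viaEmbedding_apply σ (Fin.succEmb n) i

lemma shiftHom_zero {n : ℕ} (σ : Equiv.Perm (Fin n)) : shiftHom n σ 0 = 0 :=
  Equiv.Perm.viaEmbedding_apply_of_notMem σ (Fin.succEmb n) 0
    (by simp)

lemma shiftHom_mem_adjacentTranspositions {n : ℕ} {t : Equiv.Perm (Fin n)}
    (ht : t ∈ adjacentTranspositions n) : shiftHom n t ∈ adjacentTranspositions (n + 1) := by
  obtain ⟨i, h, rfl⟩ := ht
  refine ⟨i + 1, by omega, Equiv.ext fun x => ?_⟩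
  refine Fin.cases ?_ (fun x => ?_) x
  · rw [shiftHom_zero, Equiv.swap_apply_of_ne_of_ne] <;> simp [Fin.ext_iff]
  · rw [shiftHom_succ]
    exact (Fin.succ_injective n).map_swap _ _ x

/-- There are at least `∏ k < n, min m (k + 1)` products of at most `n * (m - 1)` adjacent
transpositions in `S_n`. -/
lemma exists_finset_adjacentTranspositions_prod (m n : ℕ) :
    ∃ A : Finset (Equiv.Perm (Fin n)), A.card = ∏ k ∈ Finset.range n, min m (k + 1) ∧
      ∀ σ ∈ A, ∃ l : List (Equiv.Perm (Fin n)), l.length ≤ n * (m - 1) ∧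
        (∀ t ∈ l, t ∈ adjacentTranspositions n) ∧ l.prod = σ := by
  induction n with
  | zero => exact ⟨{1}, by simp, fun σ hσ => ⟨[], by simp, by simp, Subsingleton.elim _ _⟩⟩
  | succ n ih =>
    obtain ⟨A, hcard, hA⟩ := ih
    choose c hlen hadj hprod using exists_adjacentTranspositions_prod_zero n
    let f : Equiv.Perm (Fin n) × Fin (min m (n + 1)) → Equiv.Perm (Fin (n + 1)) := fun p =>
      (c p.2 (p.2.2.trans_le (min_le_right _ _))).prod * shiftHom n p.1
    have hf : Function.Injective f := by
      rintro ⟨σ, i⟩ ⟨τ, j⟩ h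
      have hij : i = j := by
        have := congrArg (fun g : Equiv.Perm (Fin (n + 1)) => g 0) h
        simpa [f, shiftHom_zero, hprod, Fin.ext_iff] using this
      subst hij
      exact Prod.ext (shiftHom_injective n (mul_left_cancel h)) rfl
    refine ⟨(A ×ˢ Finset.univ).map ⟨f, hf⟩, ?_, ?_⟩
    · simp [hcard, Finset.prod_range_succ]
    · intro σ hσ
      obtain ⟨⟨τ, j⟩, hτ, rfl⟩ := Finset.mem_map.1 hσ
      obtain ⟨l, hl, hla, rfl⟩ := hA τ (Finset.mem_product.1 hτ).1
      refine ⟨c j (j.2.trans_le (min_le_right _ _)) ++ l.map (shiftHom n), ?_, ?_, ?_⟩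
      · have := j.2.trans_le (min_le_left _ _)
        rw [List.length_append, List.length_map, hlen, add_mul, one_mul]
        omega
      · intro t ht
        rcases List.mem_append.1 ht with ht | ht
        · exact hadj _ _ t ht
        · obtain ⟨s, hs, rfl⟩ := List.mem_map.1 ht
          exact shiftHom_mem_adjacentTranspositions (hla s hs)
      · simp [f, List.prod_append, map_list_prod]

lemma prod_range_min_succ {m n : ℕ} (h : m ≤ n) :
    ∏ k ∈ Finset.range n, min m (k + 1) = m.factorial * m ^ (n - m) := by
  obtain ⟨d, rfl⟩ := Nat.exists_eq_add_of_le h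
  rw [Finset.prod_range_add, ← Finset.prod_range_add_one_eq_factorial, Nat.add_sub_cancel_left]
  congr 1
  · exact Finset.prod_congr rfl fun k hk => min_eq_right (Finset.mem_range.1 hk)
  · rw [Finset.prod_congr rfl fun k _ => min_eq_left (by omega : m ≤ m + k + 1)]
    simp

/-- With `m = 1 + ⌊D/n⌋ ≤ n`, the Kendall τ-ball satisfies `B_K(D) ≥ m!·m^(n-m)`. -/
theorem stmt_7 (n D : ℕ) (hn : 0 < n) (hD : 0 < D) (m : ℕ) (hm : m = 1 + D / n)
    (hmn : m ≤ n) :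
    kendallBall n D ≥ m.factorial * m ^ (n - m) := by
  obtain ⟨A, hcard, hA⟩ := exists_finset_adjacentTranspositions_prod m n
  have hmD : n * (m - 1) ≤ D := by
    rw [hm, Nat.add_sub_cancel_left]
    exact Nat.mul_div_le D n
  rw [← prod_range_min_succ hmn, ← hcard, ← Finset.card_map (Equiv.inv _).toEmbedding]
  refine Finset.card_le_card fun σ hσ => ?_
  obtain ⟨τ, hτ, rfl⟩ := Finset.mem_map.1 hσ
  obtain ⟨l, hl, hla, rfl⟩ := hA τ hτ
  refine Finset.mem_filter.2 ⟨Finset.mem_univ _, le_trans (Nat.sInf_le ?_) (hl.trans hmD)⟩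
  exact ⟨l, rfl, hla, (inv_mul_cancel l.prod).symm⟩
end

section
/- Let n be a positive integer and let r be an integer with 0 ≤ r < n. Then B_K(r) ≥ (1/4)·C(n+r−1, r), where C(·,·) denotes the binomial coefficient. -/
/-- The permutations of `Fin n` that are products of at most `r` adjacent transpositions. -/
noncomputable def shortWordPerms (n r : ℕ) : Finset (Equiv.Perm (Fin n)) :=
  open Classical in
  Finset.univ.filter fun σ => ∃ l : List (Equiv.Perm (Fin n)),
    l.length ≤ r ∧ (∀ t ∈ l, t ∈ adjacentTranspositions n) ∧ l.prod = σ

theorem mem_shortWordPerms {n r : ℕ} {σ : Equiv.Perm (Fin n)} :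
    σ ∈ shortWordPerms n r ↔ ∃ l : List (Equiv.Perm (Fin n)),
      l.length ≤ r ∧ (∀ t ∈ l, t ∈ adjacentTranspositions n) ∧ l.prod = σ := by
  simp [shortWordPerms]

theorem mul_mem_shortWordPerms {n r s : ℕ} {σ τ : Equiv.Perm (Fin n)}
    (hσ : σ ∈ shortWordPerms n r) (hτ : τ ∈ shortWordPerms n s) :
    σ * τ ∈ shortWordPerms n (r + s) := by
  rw [mem_shortWordPerms] at *
  obtain ⟨l, hl, hadj, rfl⟩ := hσ
  obtain ⟨m, hm, hadj', rfl⟩ := hτ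
  refine ⟨l ++ m, by simp; omega, fun t ht => ?_, by simp⟩
  rcases List.mem_append.1 ht with h | h
  exacts [hadj t h, hadj' t h]

theorem card_shortWordPerms_le_kendallBall (n r : ℕ) :
    (shortWordPerms n r).card ≤ kendallBall n r := by
  refine Finset.card_le_card_of_injOn (fun σ => σ⁻¹) (fun σ hσ => ?_) inv_injective.injOn
  obtain ⟨l, hl, hadj, rfl⟩ := mem_shortWordPerms.1 hσ
  have hdist : kendallDist l.prod⁻¹ 1 ≤ l.length := Nat.sInf_le ⟨l, rfl, hadj, by simp⟩
  simpa using hdist.trans hl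

/-- The embedding of `S_n` into `S_{n+1}` as the stabilizer of `0`. -/
noncomputable def permSuccHom (n : ℕ) : Equiv.Perm (Fin n) →* Equiv.Perm (Fin (n + 1)) :=
  Equiv.Perm.viaEmbeddingHom (Fin.succEmb n)

theorem permSuccHom_zero {n : ℕ} (σ : Equiv.Perm (Fin n)) : permSuccHom n σ 0 = 0 := by
  apply Equiv.Perm.viaEmbedding_apply_of_notMem
  simp

theorem permSuccHom_succ {n : ℕ} (σ : Equiv.Perm (Fin n)) (i : Fin n) :
    permSuccHom n σ i.succ = (σ i).succ :=
  Equiv.Perm.viaEmbedding_apply σ (Fin.succEmb n) i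

theorem permSuccHom_mem_adjacentTranspositions {n : ℕ} {t : Equiv.Perm (Fin n)}
    (ht : t ∈ adjacentTranspositions n) : permSuccHom n t ∈ adjacentTranspositions (n + 1) := by
  obtain ⟨i, hi, rfl⟩ := ht
  refine ⟨i + 1, by omega, Equiv.ext fun x => ?_⟩
  refine Fin.cases ?_ (fun x => ?_) x
  · rw [permSuccHom_zero, Equiv.swap_apply_of_ne_of_ne] <;> simp [Fin.ext_iff]
  · rw [permSuccHom_succ]
    exact (Fin.succ_injective n).map_swap _ _ _

theorem permSuccHom_mem_shortWordPerms {n r : ℕ} {σ : Equiv.Perm (Fin n)}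
    (hσ : σ ∈ shortWordPerms n r) : permSuccHom n σ ∈ shortWordPerms (n + 1) r := by
  rw [mem_shortWordPerms] at *
  obtain ⟨l, hl, hadj, rfl⟩ := hσ
  refine ⟨l.map (permSuccHom n), by simpa using hl, fun t ht => ?_, by rw [map_list_prod]⟩
  obtain ⟨s, hs, rfl⟩ := List.mem_map.1 ht
  exact permSuccHom_mem_adjacentTranspositions (hadj s hs)

/-- Some product of `j` adjacent transpositions moves `j` to `0`. -/
theorem exists_mem_shortWordPerms_apply_eq_zero {n : ℕ} (j : ℕ) (hj : j < n + 1) :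
    ∃ τ ∈ shortWordPerms (n + 1) j, τ ⟨j, hj⟩ = 0 := by
  induction j with
  | zero => exact ⟨1, mem_shortWordPerms.2 ⟨[], by simp⟩, by simp⟩
  | succ j ih =>
    obtain ⟨τ, hτ, h0⟩ := ih (by omega)
    refine ⟨τ * Equiv.swap ⟨j, by omega⟩ ⟨j + 1, hj⟩, mul_mem_shortWordPerms hτ
      (mem_shortWordPerms.2 ⟨[Equiv.swap ⟨j, by omega⟩ ⟨j + 1, hj⟩], by simp, ?_, by simp⟩), ?_⟩
    · simp only [List.mem_singleton, forall_eq]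
      exact ⟨j, hj, rfl⟩
    · simpa using h0

theorem sum_card_shortWordPerms_le (n r : ℕ) :
    ∑ k ∈ Finset.range (r + 1) with r ≤ k + n, (shortWordPerms n k).card ≤
      (shortWordPerms (n + 1) r).card := by
  choose τ hτ h0 using @exists_mem_shortWordPerms_apply_eq_zero n
  rw [← Finset.card_sigma]
  refine Finset.card_le_card_of_injOn
    (fun p => permSuccHom n p.2 * if h : r - p.1 < n + 1 then τ (r - p.1) h else 1) ?_ ?_
  · rintro ⟨k, σ⟩ hp
    simp only [Finset.coe_sigma, Set.mem_sigma_iff, Finset.mem_coe, Finset.mem_filter,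
      Finset.mem_range] at hp
    obtain ⟨⟨hk, hkn⟩, hσ⟩ := hp
    have hlt : r - k < n + 1 := by omega
    have := mul_mem_shortWordPerms (permSuccHom_mem_shortWordPerms hσ) (hτ (r - k) hlt)
    rw [show k + (r - k) = r by omega] at this
    simpa [hlt] using this
  · rintro ⟨k, σ⟩ hp ⟨k', σ'⟩ hp' heq
    simp only [Finset.coe_sigma, Set.mem_sigma_iff, Finset.mem_coe, Finset.mem_filter,
      Finset.mem_range] at hp hp'
    have hlt : r - k < n + 1 := by omega
    have hlt' : r - k' < n + 1 := by omega
    simp only [hlt, hlt', dite_true] at heq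
    have hz : ∀ (ρ : Equiv.Perm (Fin n)) (j : ℕ) (hj : j < n + 1),
        (permSuccHom n ρ * τ j hj) ⟨j, hj⟩ = 0 := fun ρ j hj => by
      rw [Equiv.Perm.mul_apply, h0, permSuccHom_zero]
    have hj : (⟨r - k, hlt⟩ : Fin (n + 1)) = ⟨r - k', hlt'⟩ :=
      (permSuccHom n σ * τ (r - k) hlt).injective (by rw [hz, heq, hz])
    obtain rfl : k = k' := by
      have := Fin.ext_iff.1 hj
      simp only at this
      omega
    have := Equiv.Perm.viaEmbeddingHom_injective (Fin.succEmb n) (mul_right_cancel heq)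
    rw [this]

/-- The number of `(n + 1)`-tuples of naturals with sum `r` and a given entry at least `i`. -/
def shiftedChoose (n r i : ℕ) : ℕ :=
  if i ≤ r then (n + (r - i)).choose n else 0

theorem sum_range_shiftedChoose (n r i : ℕ) :
    ∑ k ∈ Finset.range (r + 1), shiftedChoose n k i = shiftedChoose (n + 1) r i := by
  induction r with
  | zero => rcases i with _ | i <;> simp [shiftedChoose]
  | succ r ih =>
    rw [Finset.sum_range_succ, ih]
    unfold shiftedChoose
    rcases lt_trichotomy i (r + 1) with h | h | h
    · rw [if_pos (by omega), if_pos (by omega), if_pos (by omega),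
        show n + 1 + (r + 1 - i) = n + 1 + (r - i) + 1 by omega, Nat.choose_succ_succ,
        show n + (r + 1 - i) = n + 1 + (r - i) by omega, add_comm]
    · subst h
      simp
    · rw [if_neg (by omega), if_neg (by omega), if_neg (by omega)]

theorem sum_filter_shiftedChoose (n m r : ℕ) :
    ∑ k ∈ Finset.range (r + 1) with ¬ r ≤ k + m, shiftedChoose n k 0 =
      shiftedChoose (n + 1) r (m + 1) := by
  by_cases h : m + 1 ≤ r
  · have : (Finset.range (r + 1)).filter (fun k => ¬ r ≤ k + m) =
        Finset.range (r - (m + 1) + 1) := by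
      ext k
      simp only [Finset.mem_filter, Finset.mem_range]
      omega
    rw [this, sum_range_shiftedChoose]
    simp [shiftedChoose, h]
  · rw [shiftedChoose, if_neg h]
    refine Finset.sum_eq_zero fun k hk => ?_
    simp only [Finset.mem_filter, Finset.mem_range] at hk
    omega

/-- The union bound over the entries of a Lehmer code that may exceed their range. -/
theorem shiftedChoose_zero_le (n r : ℕ) :
    shiftedChoose n r 0 ≤
      (shortWordPerms (n + 1) r).card + ∑ i ∈ Finset.range n, shiftedChoose n r (i + 2) := by
  induction n generalizing r with
  | zero =>
    have : 0 < (shortWordPerms (0 + 1) r).card :=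
      Finset.card_pos.2 ⟨1, mem_shortWordPerms.2 ⟨[], by simp⟩⟩
    simpa [shiftedChoose] using this
  | succ n ih =>
    rw [Finset.sum_range_succ, ← sum_range_shiftedChoose n r 0,
      ← Finset.sum_filter_add_sum_filter_not _ (fun k => r ≤ k + (n + 1)),
      sum_filter_shiftedChoose, ← add_assoc]
    gcongr
    calc ∑ k ∈ Finset.range (r + 1) with r ≤ k + (n + 1), shiftedChoose n k 0
        ≤ ∑ k ∈ Finset.range (r + 1) with r ≤ k + (n + 1), ((shortWordPerms (n + 1) k).card +
            ∑ i ∈ Finset.range n, shiftedChoose n k (i + 2)) :=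
          Finset.sum_le_sum fun k _ => ih k
      _ = ∑ k ∈ Finset.range (r + 1) with r ≤ k + (n + 1), (shortWordPerms (n + 1) k).card +
            ∑ k ∈ Finset.range (r + 1) with r ≤ k + (n + 1),
              ∑ i ∈ Finset.range n, shiftedChoose n k (i + 2) := Finset.sum_add_distrib
      _ ≤ (shortWordPerms (n + 1 + 1) r).card +
            ∑ k ∈ Finset.range (r + 1), ∑ i ∈ Finset.range n, shiftedChoose n k (i + 2) := by
          gcongr
          · exact sum_card_shortWordPerms_le (n + 1) r
          · exact Finset.filter_subset _ _
      _ = _ := by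
          rw [Finset.sum_comm]
          simp only [sum_range_shiftedChoose]

theorem two_mul_shiftedChoose_succ_le {n r : ℕ} (hr : r ≤ n) (i : ℕ) :
    2 * shiftedChoose n r (i + 1) ≤ shiftedChoose n r i := by
  unfold shiftedChoose
  by_cases h : i + 1 ≤ r
  · rw [if_pos h, if_pos (by omega)]
    obtain ⟨k, rfl⟩ := Nat.exists_eq_add_of_le h
    rw [show i + 1 + k - (i + 1) = k by omega, show i + 1 + k - i = k + 1 by omega,
      Nat.choose_symm_add, Nat.choose_symm_add]
    have key := Nat.add_one_mul_choose_eq (n + k) k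
    rw [show n + (k + 1) = n + k + 1 by omega]
    refine Nat.le_of_mul_le_mul_right ?_ (Nat.succ_pos k)
    calc 2 * (n + k).choose k * (k + 1) = (2 * (k + 1)) * (n + k).choose k := by ring
      _ ≤ (n + k + 1) * (n + k).choose k := Nat.mul_le_mul_right _ (by omega)
      _ = _ := key
  · simp [h]

theorem sum_shiftedChoose_add_le {n r : ℕ} (hr : r ≤ n) (m : ℕ) :
    ∑ i ∈ Finset.range m, shiftedChoose n r (i + 2) + shiftedChoose n r (m + 1) ≤
      shiftedChoose n r 1 := by
  induction m with
  | zero => simp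
  | succ m ih =>
    have : 2 * shiftedChoose n r (m + 2) ≤ shiftedChoose n r (m + 1) :=
      two_mul_shiftedChoose_succ_le hr (m + 1)
    rw [Finset.sum_range_succ, show m + 1 + 1 = m + 2 from rfl]
    omega

theorem choose_le_two_mul_kendallBall {n r : ℕ} (hr : r ≤ n) :
    (n + r).choose r ≤ 2 * kendallBall (n + 1) r := by
  have h₁ := shiftedChoose_zero_le n r
  have h₂ := sum_shiftedChoose_add_le hr n
  have h₃ := two_mul_shiftedChoose_succ_le hr 0
  have h₄ := card_shortWordPerms_le_kendallBall (n + 1) r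
  have h₅ : shiftedChoose n r 0 = (n + r).choose r := by
    simpa [shiftedChoose] using Nat.choose_symm_add
  simp only [zero_add] at h₃
  omega

/-- For `0 ≤ r < n`, the Kendall τ-ball satisfies `B_K(r) ≥ (1/4)·C(n+r-1, r)`. -/
theorem stmt_8 (n r : ℕ) (hn : 0 < n) (hr : r < n) :
    (kendallBall n r : ℝ) ≥ (1 / 4) * (((n + r - 1).choose r : ℕ) : ℝ) := by
  obtain ⟨m, rfl⟩ := Nat.exists_eq_succ_of_ne_zero hn.ne'
  have h : (((m + r).choose r : ℕ) : ℝ) ≤ 2 * kendallBall (m + 1) r := by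
    exact_mod_cast choose_le_two_mul_kendallBall (Nat.lt_succ_iff.1 hr)
  rw [show m.succ + r - 1 = m + r by omega]
  have : (0 : ℝ) ≤ kendallBall (m + 1) r := Nat.cast_nonneg _
  simp only [Nat.succ_eq_add_one]
  linarith
end

section
/- Let n and D be positive integers. Every code C ⊆ S_n such that d_K(π,C) ≤ D for all π ∈ S_n satisfies |C| ≥ n! · D^D · n^n / (n+D)^{n+D}. (Equivalently, with δ = D/n, the rate satisfies (1/n)·lg(|C|/n!) ≥ −lg((1+δ)^{1+δ}/δ^δ).) -/
namespace Kendall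

open Finset

variable {n : ℕ}

/-- The set of inversions of `σ`, as pairs of positions. -/
def inversions (σ : Equiv.Perm (Fin n)) : Finset (Fin n × Fin n) :=
  univ.filter fun p => p.1 < p.2 ∧ σ p.2 < σ p.1

/-- The Lehmer code of `σ`: the number of larger entries preceding each position. -/
def lehmer (σ : Equiv.Perm (Fin n)) (i : Fin n) : ℕ :=
  #{j | j < i ∧ σ i < σ j}

theorem lehmer_lt (σ : Equiv.Perm (Fin n)) (i : Fin n) : lehmer σ i < n := by
  calc lehmer σ i ≤ #(Iio i) := card_le_card fun j => by simp +contextual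
    _ = i := by simp
    _ < n := i.2

theorem sum_lehmer (σ : Equiv.Perm (Fin n)) : ∑ i, lehmer σ i = #(inversions σ) := by
  simp only [lehmer, inversions, card_filter]
  rw [← univ_product_univ, sum_product_right]

theorem lehmer_injective : Function.Injective (lehmer (n := n)) := by
  have key : ∀ (σ τ : Equiv.Perm (Fin n)) (i : Fin n), (∀ j, i < j → σ j = τ j) →
      σ i < τ i → lehmer τ i < lehmer σ i := by
    intro σ τ i hagree hlt
    have hcard : ∀ ρ : Equiv.Perm (Fin n), lehmer ρ i = #{v | ρ.symm v < i ∧ ρ i < v} := by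
      intro ρ
      refine card_bij (fun j _ => ρ j) ?_ (fun _ _ _ _ h => ρ.injective h) ?_
      · simp
      · intro v hv
        exact ⟨ρ.symm v, by simpa using hv, by simp⟩
    have hpre : ∀ v, τ.symm v ≤ i → σ i < v → σ.symm v < i := by
      intro v hv hlt'
      by_contra! h
      rcases h.eq_or_lt with h | h
      · rw [h] at hlt'
        simp at hlt'
      · have h' := hagree _ h
        rw [Equiv.apply_symm_apply] at h'
        rw [h', Equiv.symm_apply_apply] at hv
        exact absurd hv h.not_ge
    rw [hcard, hcard]
    refine card_lt_card (ssubset_iff_of_subset ?_ |>.2 ⟨τ i, ?_, ?_⟩)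
    · intro v
      simp only [mem_filter, mem_univ, true_and]
      rintro ⟨h, h'⟩
      exact ⟨hpre v h.le (hlt.trans h'), hlt.trans h'⟩
    · simpa using ⟨hpre (τ i) (by simp) hlt, hlt⟩
    · simp
  intro σ τ h
  by_contra hne
  obtain ⟨i, hi, hmax⟩ : ∃ i, σ i ≠ τ i ∧ ∀ j, i < j → σ j = τ j := by
    have hs : (univ.filter fun i => σ i ≠ τ i).Nonempty := by
      obtain ⟨i, hi⟩ := not_forall.1 (mt Equiv.ext hne)
      exact ⟨i, by simpa using hi⟩
    obtain ⟨i, hi, hmax⟩ := exists_max_image _ id hs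
    refine ⟨i, by simpa using hi, fun j hj => ?_⟩
    by_contra hj'
    exact absurd (hmax j (by simpa using hj')) (by simpa using hj)
  rcases lt_or_gt_of_ne hi with hlt | hlt
  · exact (key σ τ i hmax hlt).ne (congrFun h i).symm
  · exact (key τ σ i (fun j hj => (hmax j hj).symm) hlt).ne (congrFun h i)

theorem card_inversions_mul_le (σ t : Equiv.Perm (Fin n)) (ht : t ∈ adjacentTranspositions n) :
    #(inversions (σ * t)) ≤ #(inversions σ) + 1 := by
  obtain ⟨i, hi, rfl⟩ := ht
  set a : Fin n := ⟨i, Nat.lt_of_succ_lt hi⟩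
  set b : Fin n := ⟨i + 1, hi⟩
  have hmono : ∀ x y : Fin n, x < y → (x, y) ≠ (a, b) →
      Equiv.swap a b x < Equiv.swap a b y := by
    intro x y hxy hne
    simp only [ne_eq, Prod.mk.injEq, Fin.ext_iff, a, b] at hne
    simp only [Equiv.swap_apply_def, Fin.ext_iff, a, b]
    split_ifs <;> simp only [Fin.lt_def] at * <;> omega
  have hle : #((inversions (σ * Equiv.swap a b)).erase (a, b)) ≤ #(inversions σ) := by
    refine card_le_card_of_injOn (Prod.map (Equiv.swap a b) (Equiv.swap a b)) ?_
      ((Equiv.injective _).prodMap (Equiv.injective _)).injOn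
    rintro ⟨x, y⟩ h
    obtain ⟨hne, hinv⟩ := mem_erase.1 (mem_coe.1 h)
    obtain ⟨hlt, hgt⟩ := (mem_filter.1 hinv).2
    simpa [inversions] using ⟨hmono x y hlt hne, hgt⟩
  have := pred_card_le_card_erase (s := inversions (σ * Equiv.swap a b)) (a := (a, b))
  omega

theorem card_inversions_prod_le (l : List (Equiv.Perm (Fin n)))
    (hl : ∀ t ∈ l, t ∈ adjacentTranspositions n) : #(inversions l.prod) ≤ l.length := by
  induction l using List.reverseRecOn with
  | nil =>
    simp only [List.prod_nil, List.length_nil, Nat.le_zero, card_eq_zero]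
    refine filter_eq_empty_iff.2 fun p _ h => ?_
    exact lt_asymm h.1 h.2
  | append_singleton l t ih =>
    rw [List.prod_append, List.prod_singleton, List.length_append, List.length_singleton]
    exact (card_inversions_mul_le _ t (hl t (by simp))).trans
      (Nat.add_le_add_right (ih fun s hs => hl s (by simp [hs])) 1)

theorem exists_list_prod_eq (σ : Equiv.Perm (Fin n)) :
    ∃ l : List (Equiv.Perm (Fin n)), (∀ t ∈ l, t ∈ adjacentTranspositions n) ∧ l.prod = σ := by
  cases n with
  | zero => exact ⟨[], by simp, Subsingleton.elim _ _⟩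
  | succ n =>
    have hσ : σ ∈ Submonoid.closure
        (Set.range fun i : Fin n => Equiv.swap i.castSucc i.succ) := by
      rw [Equiv.Perm.mclosure_swap_castSucc_succ]
      trivial
    obtain ⟨l, hl, rfl⟩ := Submonoid.exists_list_of_mem_closure hσ
    refine ⟨l, fun t ht => ?_, rfl⟩
    obtain ⟨i, rfl⟩ := hl t ht
    exact ⟨i, by omega, rfl⟩

theorem card_inversions_inv_mul_le (π σ : Equiv.Perm (Fin n)) :
    #(inversions (π⁻¹ * σ)) ≤ kendallDist π σ := by
  obtain ⟨l₀, hl₀, hprod⟩ := exists_list_prod_eq (π⁻¹ * σ)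
  obtain ⟨l, hlen, hl, h⟩ := Nat.sInf_mem
    (s := {k | ∃ l : List (Equiv.Perm (Fin n)), l.length = k ∧
      (∀ t ∈ l, t ∈ adjacentTranspositions n) ∧ σ = π * l.prod})
    ⟨_, l₀, rfl, hl₀, by simp [hprod]⟩
  rw [kendallDist, ← hlen, h, inv_mul_cancel_left]
  exact card_inversions_prod_le l hl

/-- The generating function of inversions is at most `(1 - x)⁻ⁿ`. -/
theorem sum_pow_card_inversions_le {x : ℝ} (hx : 0 ≤ x) (hx1 : x < 1) :
    ∑ σ : Equiv.Perm (Fin n), x ^ #(inversions σ) ≤ ((1 - x)⁻¹) ^ n := by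
  have hgeom : ∑ k ∈ range n, x ^ k ≤ (1 - x)⁻¹ := by
    rw [← tsum_geometric_of_lt_one hx hx1]
    exact (summable_geometric_of_lt_one hx hx1).sum_le_tsum _ fun k _ => pow_nonneg hx k
  calc ∑ σ : Equiv.Perm (Fin n), x ^ #(inversions σ)
      = ∑ σ : Equiv.Perm (Fin n), ∏ i, x ^ lehmer σ i := by
        simp_rw [prod_pow_eq_pow_sum, sum_lehmer]
    _ = ∑ f ∈ univ.image (lehmer (n := n)), ∏ i, x ^ f i :=
        (sum_image (f := fun f : Fin n → ℕ => ∏ i, x ^ f i) lehmer_injective.injOn).symm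
    _ ≤ ∑ f ∈ Fintype.piFinset fun _ : Fin n => range n, ∏ i, x ^ f i := by
        refine sum_le_sum_of_subset_of_nonneg ?_ fun f _ _ => prod_nonneg fun i _ =>
          pow_nonneg hx _
        intro f hf
        obtain ⟨σ, -, rfl⟩ := mem_image.1 hf
        simpa using lehmer_lt σ
    _ = (∑ k ∈ range n, x ^ k) ^ n := by
        rw [← prod_univ_sum (fun _ : Fin n => range n) fun _ k => x ^ k]
        simp
    _ ≤ ((1 - x)⁻¹) ^ n := by
        gcongr

theorem card_inversions_le_mul_pow_le (D : ℕ) {x : ℝ} (hx : 0 ≤ x) (hx1 : x < 1) :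
    (#{σ : Equiv.Perm (Fin n) | #(inversions σ) ≤ D} : ℝ) * x ^ D ≤ ((1 - x)⁻¹) ^ n := by
  refine le_trans ?_ (sum_pow_card_inversions_le hx hx1)
  rw [← nsmul_eq_mul]
  refine (card_nsmul_le_sum _ (fun σ => x ^ #(inversions σ)) _ fun σ hσ =>
    pow_le_pow_of_le_one hx hx1.le (mem_filter.1 hσ).2).trans ?_
  exact sum_le_sum_of_subset_of_nonneg (filter_subset _ _) fun σ _ _ => pow_nonneg hx _

theorem factorial_le_card_mul (D : ℕ) (C : Finset (Equiv.Perm (Fin n)))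
    (hcov : ∀ π : Equiv.Perm (Fin n), ∃ σ ∈ C, kendallDist π σ ≤ D) :
    n.factorial ≤ #C * #{σ : Equiv.Perm (Fin n) | #(inversions σ) ≤ D} := by
  have hcard : #(univ : Finset (Equiv.Perm (Fin n))) = n.factorial := by
    simp [Fintype.card_perm]
  rw [← hcard, ← card_product]
  refine card_le_card_of_surjOn (fun p => p.1 * p.2⁻¹) fun π _ => ?_
  obtain ⟨σ, hσ, hd⟩ := hcov π
  exact ⟨(σ, π⁻¹ * σ), by simpa using ⟨hσ, (card_inversions_inv_mul_le π σ).trans hd⟩,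
    by simp⟩

end Kendall


/-- Every code with worst-case Kendall τ-distortion at most `D` has size at least
`n!·D^D·n^n / (n+D)^(n+D)`. -/
theorem stmt_9 (n D : ℕ) (hn : 0 < n) (hD : 0 < D)
    (C : Finset (Equiv.Perm (Fin n)))
    (hcov : ∀ π : Equiv.Perm (Fin n), ∃ σ ∈ C, kendallDist π σ ≤ D) :
    (C.card : ℝ) ≥ (n.factorial : ℝ) * (D : ℝ) ^ D * (n : ℝ) ^ n /
      ((n : ℝ) + (D : ℝ)) ^ (n + D) := by
  have hn' : (0 : ℝ) < n := Nat.cast_pos.2 hn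
  have hD' : (0 : ℝ) < D := Nat.cast_pos.2 hD
  have hs : (0 : ℝ) < n + D := by positivity
  set B : ℝ := ((Finset.univ.filter fun σ : Equiv.Perm (Fin n) =>
    (Kendall.inversions σ).card ≤ D).card : ℝ)
  have hfact : (n.factorial : ℝ) ≤ C.card * B := by
    rw [← Nat.cast_mul]
    exact Nat.cast_le.2 (Kendall.factorial_le_card_mul D C hcov)
  have hball : B * ((D : ℝ) / (n + D)) ^ D ≤ ((1 - (D : ℝ) / (n + D))⁻¹) ^ n :=
    Kendall.card_inversions_le_mul_pow_le D (by positivity) ((div_lt_one hs).2 (by linarith))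
  have hx : (1 - (D : ℝ) / (n + D))⁻¹ = (n + D) / n := by
    rw [one_sub_div hs.ne', add_sub_cancel_right, inv_div]
  rw [hx, div_pow, div_pow, mul_div_assoc', div_le_div_iff₀ (by positivity) (by positivity)]
    at hball
  rw [ge_iff_le, div_le_iff₀ (by positivity)]
  calc (n.factorial : ℝ) * (D : ℝ) ^ D * (n : ℝ) ^ n
      ≤ C.card * B * (D : ℝ) ^ D * (n : ℝ) ^ n := by gcongr
    _ = C.card * (B * (D : ℝ) ^ D * (n : ℝ) ^ n) := by ring
    _ ≤ C.card * (((n : ℝ) + D) ^ n * ((n : ℝ) + D) ^ D) := by gcongr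
    _ = C.card * ((n : ℝ) + D) ^ (n + D) := by rw [pow_add]
end

section
/- Let n and D be positive integers. Every code C ⊆ S_n with average Kendall τ-distortion at most D, i.e. (1/n!)·∑_{π∈S_n} d_K(π,C) ≤ D, satisfies |C| ≥ n! · D^D · n^n / (n · (n+D)^{n+D}). (Equivalently, with δ = D/n, (1/n)·lg(|C|/n!) ≥ −lg((1+δ)^{1+δ}/δ^δ) − (lg n)/n.) -/
open Finset

/-- The inversions of `σ`: pairs of positions `a < b` with `σ b < σ a`. -/
def inversions {n : ℕ} (σ : Equiv.Perm (Fin n)) : Finset (Fin n × Fin n) :=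
  univ.filter fun p => p.1 < p.2 ∧ σ p.2 < σ p.1

lemma mem_inversions {n : ℕ} {σ : Equiv.Perm (Fin n)} {p : Fin n × Fin n} :
    p ∈ inversions σ ↔ p.1 < p.2 ∧ σ p.2 < σ p.1 := by
  simp [inversions]

/-- The Lehmer code of `σ`: entry `i` counts the values below `σ i` occurring at or after
position `i`. -/
def lehmerCode {n : ℕ} (σ : Equiv.Perm (Fin n)) (i : Fin n) : ℕ :=
  (univ.filter fun v => i ≤ σ.symm v ∧ v < σ i).card

lemma lehmerCode_lt {n : ℕ} (σ : Equiv.Perm (Fin n)) (i : Fin n) : lehmerCode σ i < n := by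
  have h : (univ.filter fun v => i ≤ σ.symm v ∧ v < σ i) ⊂ (univ : Finset (Fin n)) := by
    rw [Finset.ssubset_univ_iff]
    intro h
    have := h ▸ mem_univ (σ i)
    simp at this
  simpa [lehmerCode] using card_lt_card h

lemma sum_lehmerCode {n : ℕ} (σ : Equiv.Perm (Fin n)) :
    ∑ i, lehmerCode σ i = (inversions σ).card := by
  have h : (inversions σ).card =
      ∑ i, ((inversions σ).filter fun p => p.1 = i).card :=
    card_eq_sum_card_fiberwise (fun _ _ => mem_univ _)
  rw [h]
  refine sum_congr rfl fun i _ => ?_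
  refine card_bij' (fun v _ => (i, σ.symm v)) (fun p _ => σ p.2) ?_ ?_ ?_ ?_
  · intro v hv
    simp only [mem_filter, mem_univ, true_and] at hv
    have hne : i ≠ σ.symm v := by
      rintro rfl
      simp at hv
    simp [inversions, hv.2, lt_of_le_of_ne hv.1 hne]
  · rintro ⟨a, b⟩ hp
    simp only [inversions, mem_filter, mem_univ, true_and] at hp
    obtain ⟨⟨hab, hσ⟩, rfl⟩ := hp
    simp [hab.le, hσ]
  · simp
  · rintro ⟨a, b⟩ hp
    simp only [mem_filter] at hp
    simp [hp.2]

lemma lehmerCode_lt_of_lt {n : ℕ} {σ τ : Equiv.Perm (Fin n)} {i : Fin n}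
    (h : ∀ k < i, σ k = τ k) (hlt : σ i < τ i) : lehmerCode σ i < lehmerCode τ i := by
  have key : ∀ v, i ≤ σ.symm v → i ≤ τ.symm v := by
    intro v hv
    by_contra! hτ
    have := h _ hτ
    rw [Equiv.apply_symm_apply] at this
    rw [← this, Equiv.symm_apply_apply] at hv
    exact absurd hv (not_le.mpr hτ)
  refine card_lt_card (Finset.ssubset_iff_of_subset ?_ |>.mpr ⟨σ i, ?_, ?_⟩)
  · intro v hv
    simp only [mem_filter, mem_univ, true_and] at hv ⊢
    exact ⟨key v hv.1, hv.2.trans hlt⟩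
  · simp only [mem_filter, mem_univ, true_and]
    exact ⟨key _ (by simp), hlt⟩
  · simp

lemma lehmerCode_injective (n : ℕ) :
    Function.Injective (lehmerCode : Equiv.Perm (Fin n) → Fin n → ℕ) := by
  intro σ τ h
  ext1 i
  induction i using WellFoundedLT.induction with
  | ind i ih =>
    rcases lt_trichotomy (σ i) (τ i) with hlt | heq | hgt
    · exact absurd (congrFun h i) (lehmerCode_lt_of_lt ih hlt).ne
    · exact heq
    · exact absurd (congrFun h i) (lehmerCode_lt_of_lt (fun k hk => (ih k hk).symm) hgt).ne'

lemma sum_pow_inversions_le {n : ℕ} {q : ℝ} (hq0 : 0 ≤ q) (hq1 : q < 1) :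
    ∑ σ : Equiv.Perm (Fin n), q ^ (inversions σ).card ≤ ((1 - q)⁻¹) ^ n := by
  calc ∑ σ : Equiv.Perm (Fin n), q ^ (inversions σ).card
      = ∑ σ : Equiv.Perm (Fin n), ∏ i, q ^ lehmerCode σ i := by
        simp_rw [prod_pow_eq_pow_sum, sum_lehmerCode]
    _ = ∑ c ∈ univ.image (lehmerCode : Equiv.Perm (Fin n) → Fin n → ℕ), ∏ i, q ^ c i := by
        rw [sum_image fun _ _ _ _ h => lehmerCode_injective n h]
    _ ≤ ∑ c ∈ Fintype.piFinset (fun _ : Fin n => range n), ∏ i, q ^ c i := by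
        refine sum_le_sum_of_subset_of_nonneg ?_ fun _ _ _ => by positivity
        intro c hc
        obtain ⟨σ, -, rfl⟩ := mem_image.mp hc
        simp [lehmerCode_lt]
    _ = (∑ k ∈ range n, q ^ k) ^ n := by
        rw [sum_prod_piFinset (range n) fun _ k => q ^ k]
        simp
    _ ≤ ((1 - q)⁻¹) ^ n := by
        gcongr
        exact (tsum_geometric_of_lt_one hq0 hq1) ▸
          (summable_geometric_of_lt_one hq0 hq1).sum_le_tsum _ fun _ _ => by positivity

lemma card_inversions_le_mul_adjacent {n : ℕ} (σ : Equiv.Perm (Fin n))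
    {t : Equiv.Perm (Fin n)} (ht : t ∈ adjacentTranspositions n) :
    (inversions σ).card ≤ (inversions (σ * t)).card + 1 := by
  obtain ⟨i, hi, rfl⟩ := ht
  set x : Fin n := ⟨i, Nat.lt_of_succ_lt hi⟩ with hx
  set y : Fin n := ⟨i + 1, hi⟩ with hy
  have h : ((inversions σ).erase (x, y)).card ≤ (inversions (σ * Equiv.swap x y)).card := by
    refine card_le_card_of_injOn (fun p => (Equiv.swap x y p.1, Equiv.swap x y p.2)) ?_ ?_
    · rintro ⟨a, b⟩ hp
      rw [mem_coe, mem_erase, mem_inversions, ne_eq, Prod.mk.injEq] at hp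
      obtain ⟨hne, hab, hσ⟩ := hp
      rw [mem_coe, mem_inversions]
      refine ⟨?_, by simpa using hσ⟩
      simp only [Equiv.swap_apply_def, Fin.ext_iff, Fin.lt_def, hx, hy] at *
      split_ifs <;> simp <;> omega
    · rintro ⟨a, b⟩ - ⟨c, d⟩ - h
      simpa using h
  have := pred_card_le_card_erase (s := inversions σ) (a := (x, y))
  omega

lemma card_inversions_le_length {n : ℕ} (l : List (Equiv.Perm (Fin n))) :
    ∀ σ : Equiv.Perm (Fin n), (∀ t ∈ l, t ∈ adjacentTranspositions n) → σ * l.prod = 1 →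
      (inversions σ).card ≤ l.length := by
  induction l with
  | nil =>
    intro σ _ h
    obtain rfl : σ = 1 := by simpa using h
    have : inversions (1 : Equiv.Perm (Fin n)) = ∅ := by
      ext p
      simpa [mem_inversions] using le_of_lt
    simp [this]
  | cons t l ih =>
    intro σ hl h
    have h₁ := card_inversions_le_mul_adjacent σ (hl t (by simp))
    have h₂ := ih (σ * t) (fun s hs => hl s (by simp [hs])) (by simpa [mul_assoc] using h)
    simp only [List.length_cons]
    omega

lemma exists_adjacent_list_prod_eq {n : ℕ} (σ : Equiv.Perm (Fin n)) :
    ∃ l : List (Equiv.Perm (Fin n)), (∀ t ∈ l, t ∈ adjacentTranspositions n) ∧ l.prod = σ := by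
  cases n with
  | zero => exact ⟨[], by simp, Subsingleton.elim _ _⟩
  | succ n =>
    have h : σ ∈ Submonoid.closure
        (Set.range fun i : Fin n => Equiv.swap i.castSucc i.succ) := by
      rw [Equiv.Perm.mclosure_swap_castSucc_succ]
      trivial
    obtain ⟨l, hl, rfl⟩ := Submonoid.exists_list_of_mem_closure h
    refine ⟨l, fun t ht => ?_, rfl⟩
    obtain ⟨i, rfl⟩ := hl t ht
    exact ⟨i, by omega, rfl⟩

lemma card_inversions_le_kendallDist {n : ℕ} (σ τ : Equiv.Perm (Fin n)) :
    (inversions (τ⁻¹ * σ)).card ≤ kendallDist σ τ := by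
  refine le_csInf ?_ ?_
  · obtain ⟨l, hl, hprod⟩ := exists_adjacent_list_prod_eq (σ⁻¹ * τ)
    exact ⟨l.length, l, rfl, hl, by simp [hprod]⟩
  · rintro k ⟨l, rfl, hl, h⟩
    exact card_inversions_le_length l _ hl (by rw [mul_assoc, ← h, inv_mul_cancel])

lemma sum_pow_kendallDistToCode_le {n : ℕ} {C : Finset (Equiv.Perm (Fin n))} (hC : C.Nonempty)
    {q : ℝ} (hq0 : 0 ≤ q) (hq1 : q < 1) :
    ∑ π, q ^ kendallDistToCode π C ≤ C.card * ((1 - q)⁻¹) ^ n := by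
  have hle : ∀ π, q ^ kendallDistToCode π C ≤ ∑ c ∈ C, q ^ (inversions (c⁻¹ * π)).card := by
    intro π
    obtain ⟨c, hc, hd⟩ : kendallDistToCode π C ∈ kendallDist π '' (C : Set (Equiv.Perm (Fin n))) :=
      Nat.sInf_mem (hC.to_set.image _)
    rw [← hd]
    refine (pow_le_pow_of_le_one hq0 hq1.le (card_inversions_le_kendallDist π c)).trans ?_
    exact single_le_sum (f := fun c => q ^ (inversions (c⁻¹ * π)).card)
      (fun _ _ => by positivity) hc
  calc ∑ π, q ^ kendallDistToCode π C
      ≤ ∑ π, ∑ c ∈ C, q ^ (inversions (c⁻¹ * π)).card := sum_le_sum fun π _ => hle π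
    _ = ∑ c ∈ C, ∑ π, q ^ (inversions (c⁻¹ * π)).card := sum_comm
    _ = ∑ c ∈ C, ∑ π : Equiv.Perm (Fin n), q ^ (inversions π).card :=
        sum_congr rfl fun c _ =>
          Equiv.sum_comp (Equiv.mulLeft c⁻¹) fun π => q ^ (inversions π).card
    _ ≤ ∑ _c ∈ C, ((1 - q)⁻¹) ^ n := sum_le_sum fun _ _ => sum_pow_inversions_le hq0 hq1
    _ = C.card * ((1 - q)⁻¹) ^ n := by simp

lemma card_mul_pow_le_sum_pow {ι : Type*} [Fintype ι] {q : ℝ} (hq0 : 0 < q) (hq1 : q ≤ 1)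
    (d : ι → ℕ) (D : ℕ) (h : ∑ i, (d i : ℝ) ≤ Fintype.card ι * D) :
    Fintype.card ι * q ^ D ≤ ∑ i, q ^ d i := by
  have tangent : ∀ i, q ^ D * (1 + ((d i : ℝ) - D) * Real.log q) ≤ q ^ d i := by
    intro i
    have hexp : ∀ k : ℕ, q ^ k = Real.exp (k * Real.log q) := fun k => by
      rw [Real.exp_nat_mul, Real.exp_log hq0]
    have : q ^ d i = q ^ D * Real.exp (((d i : ℝ) - D) * Real.log q) := by
      rw [hexp, hexp, ← Real.exp_add]
      ring_nf
    rw [this]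
    gcongr
    linarith [Real.add_one_le_exp (((d i : ℝ) - D) * Real.log q)]
  refine le_trans ?_ (sum_le_sum fun i _ => tangent i)
  have hsum : ∑ i, q ^ D * (1 + ((d i : ℝ) - D) * Real.log q) =
      q ^ D * (Fintype.card ι + (∑ i, (d i : ℝ) - Fintype.card ι * D) * Real.log q) := by
    rw [← mul_sum, sum_add_distrib, ← sum_mul, sum_sub_distrib]
    simp
  rw [hsum, mul_comm]
  gcongr
  have := mul_nonneg_of_nonpos_of_nonpos (sub_nonpos.mpr h) (Real.log_nonpos hq0.le hq1)
  linarith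

/-- Every code with average Kendall τ-distortion at most `D` has size at least
`n!·D^D·n^n / (n·(n+D)^(n+D))`. -/
theorem stmt_10 (n D : ℕ) (hn : 0 < n) (hD : 0 < D)
    (C : Finset (Equiv.Perm (Fin n))) (hC : C.Nonempty)
    (havg : (∑ π : Equiv.Perm (Fin n), (kendallDistToCode π C : ℝ)) / (n.factorial : ℝ) ≤ D) :
    (C.card : ℝ) ≥ (n.factorial : ℝ) * (D : ℝ) ^ D * (n : ℝ) ^ n /
      ((n : ℝ) * ((n : ℝ) + (D : ℝ)) ^ (n + D)) := by
  have hn' : (1 : ℝ) ≤ n := by exact_mod_cast hn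
  have hD' : (0 : ℝ) < D := by exact_mod_cast hD
  have hs : (0 : ℝ) < n + D := by linarith
  have hf : (0 : ℝ) < n.factorial := by exact_mod_cast n.factorial_pos
  set q : ℝ := D / (n + D) with hq
  have hq0 : 0 < q := by positivity
  have hq1 : q < 1 := by rw [hq, div_lt_one hs]; linarith
  have hcomp : 1 - q = n / (n + D) := by rw [hq]; field_simp; ring
  have hcard : Fintype.card (Equiv.Perm (Fin n)) = n.factorial := by simp [Fintype.card_perm]
  rw [div_le_iff₀ hf] at havg
  have hlow := card_mul_pow_le_sum_pow hq0 hq1.le (fun π => kendallDistToCode π C) D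
    (by rw [hcard]; linarith)
  rw [hcard] at hlow
  have hmain := hlow.trans (sum_pow_kendallDistToCode_le hC hq0.le hq1)
  rw [inv_pow, ← div_eq_mul_inv, le_div_iff₀ (by rw [hcomp]; positivity), hcomp, hq, div_pow,
    div_pow] at hmain
  refine le_trans ?_ hmain
  have hval : (n.factorial : ℝ) * ((D : ℝ) ^ D / (n + D) ^ D) * ((n : ℝ) ^ n / (n + D) ^ n) =
      n.factorial * (D : ℝ) ^ D * (n : ℝ) ^ n / ((n : ℝ) + D) ^ (n + D) := by
    rw [pow_add]
    field_simp
  rw [hval]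
  gcongr
  exact le_mul_of_one_le_left (by positivity) hn'
end
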